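/- For ρ small enough the following holds. Let n, n′ ≥ 5, let y ∈ 𝒜_n and y′ ∈ 𝒜_{n′} be minimizers of E^red_n and E^red_{n′} respectively, with bond angles φ and φ′, and let i ∈ {1,…,n−3}, i′ ∈ {1,…,n′−3}. (a) If sgn(φ_{i+1} − π) = sgn(φ_{i+2} − π) and sgn(φ′_{i′+1} − π) = sgn(φ′_{i′+2} − π), then E^gen_cell(y_i, y_{i+1}, y_{i+2}, y_{i+3}) = E^gen_cell(y′_{i′}, y′_{i′+1}, y′_{i′+2}, y′_{i′+3}); the same equality holds if instead sgn(φ_{i+1} − π) ≠ sgn(φ_{i+2} − π) and sgn(φ′_{i′+1} − π) ≠ sgn(φ′_{i′+2} − π). Hence e^gen_cell and e_per are well defined. (b) If sgn(φ_{i+1} − π) ≠ sgn(φ_{i+2} − π) and sgn(φ′_{i′+1} − π) = sgn(φ′_{i′+2} − π), then |y_{i+3} − y_i| > |y′_{i′+3} − y′_{i′}| and E^gen_cell(y_i, y_{i+1}, y_{i+2}, y_{i+3}) > E^gen_cell(y′_{i′}, y′_{i′+1}, y′_{i′+2}, y′_{i′+3}); in particular e_per > 0. -/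

import Mathlib

open Real

attribute [local instance] Classical.propDecidable

noncomputable section

/-- Counterclockwise angle from `a` to `b`, in `[0, 2π)`. -/
def ccwAngle (a b : ℂ) : ℝ :=
  if Complex.arg (b * (starRingEnd ℂ) a) < 0 then
    Complex.arg (b * (starRingEnd ℂ) a) + 2 * π
  else Complex.arg (b * (starRingEnd ℂ) a)

/-- Bond length `b_i`. -/
def bnd (y : ℕ → ℂ) (i : ℕ) : ℝ := ‖y (i + 1) - y i‖

/-- Bond angle `φ_i = ∡(y_{i-1} − y_i, y_{i+1} − y_i)`. -/
def ang (y : ℕ → ℂ) (i : ℕ) : ℝ := ccwAngle (y (i - 1) - y i) (y (i + 1) - y i)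

/-- Admissible configurations `𝒜_n` (atoms indexed `1,…,n`). -/
def Admissible (n : ℕ) (y : ℕ → ℂ) : Prop :=
  (∀ i j : ℕ, 1 ≤ i → i ≤ n → 1 ≤ j → j ≤ n → (i + 2 ≤ j ∨ j + 2 ≤ i) →
      (1.5 : ℝ) < ‖y i - y j‖) ∧
  (∀ i : ℕ, 1 ≤ i → i + 1 ≤ n → ‖y (i + 1) - y i‖ ≤ (1.5 : ℝ))

/-- Assumptions on the two-body potential `v₂` and the three-body potential `v₃`. -/
structure PotentialPair (v₂ v₃ : ℝ → ℝ) : Prop where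
  v₂_smooth : ContDiffOn ℝ (⊤ : ℕ∞) v₂ (Set.Ioi 0)
  v₂_lb : ∀ x ∈ Set.Ioi (0 : ℝ), (-1 : ℝ) ≤ v₂ x
  v₂_min : v₂ 1 = -1
  v₂_min_unique : ∀ x ∈ Set.Ioi (0 : ℝ), x ≠ 1 → v₂ 1 < v₂ x
  v₂_conv : 0 < iteratedDeriv 2 v₂ 1
  v₂_mono : StrictMonoOn v₂ (Set.Ici 1)
  v₃_smooth : ContDiffOn ℝ (⊤ : ℕ∞) v₃ (Set.Icc 0 (2 * π))
  v₃_nonneg : ∀ x ∈ Set.Icc (0 : ℝ) (2 * π), 0 ≤ v₃ x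
  v₃_symm : ∀ φ : ℝ, v₃ (π - φ) = v₃ (π + φ)
  v₃_min : v₃ π = 0
  v₃_min_unique : ∀ x ∈ Set.Icc (0 : ℝ) (2 * π), x ≠ π → 0 < v₃ x
  v₃_d1 : deriv v₃ π = 0
  v₃_d2 : iteratedDeriv 2 v₃ π = 0
  v₃_d3 : iteratedDeriv 3 v₃ π = 0
  v₃_d4 : 0 < iteratedDeriv 4 v₃ π

/-- The cell energy in terms of bond lengths and angle. -/
def EcellT (v₂ v₃ : ℝ → ℝ) (ρ b₁ b₂ φ : ℝ) : ℝ :=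
  v₂ b₁ + v₂ b₂ + ρ * v₂ (Real.sqrt (b₁ ^ 2 + b₂ ^ 2 - 2 * b₁ * b₂ * Real.cos φ)) + v₃ φ

/-- The cell energy. -/
def Ecell (v₂ v₃ : ℝ → ℝ) (ρ : ℝ) (p q r : ℂ) : ℝ :=
  v₂ ‖q - p‖ + v₂ ‖r - q‖ + v₃ (ccwAngle (r - q) (p - q)) + ρ * v₂ ‖r - p‖

/-- The reduced energy `E^red_n`. -/
def Ered (v₂ v₃ : ℝ → ℝ) (ρ : ℝ) (n : ℕ) (y : ℕ → ℂ) : ℝ :=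
  ∑ i ∈ Finset.Icc 2 (n - 1), Ecell v₂ v₃ ρ (y (i - 1)) (y i) (y (i + 1))

/-- `(b0, b0, π ± ψ)` are the only minimizers of the cell energy. -/
def IsCellMinimizer (v₂ v₃ : ℝ → ℝ) (ρ b0 ψ : ℝ) : Prop :=
  0 < b0 ∧ b0 < 1 ∧ 0 < ψ ∧ ψ < π / 8 ∧
  (∀ b₁ ∈ Set.Ioi (0 : ℝ), ∀ b₂ ∈ Set.Ioi (0 : ℝ), ∀ φ ∈ Set.Icc (0 : ℝ) (2 * π),
      EcellT v₂ v₃ ρ b0 b0 (π + ψ) ≤ EcellT v₂ v₃ ρ b₁ b₂ φ) ∧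
  (∀ b₁ ∈ Set.Ioi (0 : ℝ), ∀ b₂ ∈ Set.Ioi (0 : ℝ), ∀ φ ∈ Set.Icc (0 : ℝ) (2 * π),
      EcellT v₂ v₃ ρ b₁ b₂ φ = EcellT v₂ v₃ ρ b0 b0 (π + ψ) →
        b₁ = b0 ∧ b₂ = b0 ∧ (φ = π + ψ ∨ φ = π - ψ))

/-- The minimal cell energy `e_cell`. -/
def eCell (v₂ v₃ : ℝ → ℝ) (ρ b0 ψ : ℝ) : ℝ := EcellT v₂ v₃ ρ b0 b0 (π + ψ)

/-- `y` is a minimizer of `E^red_n` over `𝒜_n`. -/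
def MinimizesEred (v₂ v₃ : ℝ → ℝ) (ρ : ℝ) (n : ℕ) (y : ℕ → ℂ) : Prop :=
  Admissible n y ∧ ∀ y' : ℕ → ℂ, Admissible n y' → Ered v₂ v₃ ρ n y ≤ Ered v₂ v₃ ρ n y'

/-- Single-period configurations `𝒰^l`, with transition index `i₀`. -/
def memU (b0 ψ : ℝ) (l i₀ : ℕ) (y : ℕ → ℂ) : Prop :=
  2 ≤ i₀ ∧ i₀ + 1 ≤ l ∧
  (∀ i : ℕ, 1 ≤ i → i ≤ l → bnd y i = b0) ∧
  (∀ i : ℕ, 2 ≤ i → i ≤ i₀ → ang y i = π - ψ) ∧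
  (∀ i : ℕ, i₀ + 1 ≤ i → i ≤ l → ang y i = π + ψ)

/-- `⌈2π/ψ̄⌉`. -/
def nceil (ψ : ℝ) : ℕ := ⌈2 * π / ψ⌉₊

/-- The maximal atomic period `l_max = 2⌈2π/ψ̄⌉ − 4`. -/
def lmaxN (ψ : ℝ) : ℕ := 2 * nceil ψ - 4

/-- `l_mid = ⌊6/ψ̄⌋`. -/
def lmidN (ψ : ℝ) : ℕ := ⌊(6 : ℝ) / ψ⌋₊

/-- The end-to-end length `λ^l(i₀)` of a single-period configuration. -/
def lambdaFn (b0 ψ : ℝ) (l i₀ : ℕ) : ℝ :=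
  ‖∑ k ∈ Finset.Icc 1 l, (b0 : ℂ) * Complex.exp (Complex.I *
      (((if k ≤ i₀ then -(((k : ℝ) - 1) * ψ) else ((k : ℝ) - 2 * (i₀ : ℝ) + 1) * ψ) : ℝ) : ℂ))‖

/-- The domain of the function `λ^l`. -/
def lambdaDom (ψ : ℝ) (l : ℕ) : Finset ℕ :=
  (Finset.Icc 2 (l - 1)).filter fun i₀ => l + 3 ≤ i₀ + nceil ψ ∧ i₀ + 2 ≤ nceil ψ

/-- `λ^l_max`, the maximum of `λ^l` over its domain. -/
def lambdaMax (b0 ψ : ℝ) (l : ℕ) : ℝ :=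
  sSup (lambdaFn b0 ψ l '' ↑(lambdaDom ψ l))

/-- `f` is affine on `s`. -/
def AffOn (f : ℝ → ℝ) (s : Set ℝ) : Prop := ∃ a b : ℝ, ∀ x ∈ s, f x = a * x + b

/-- `Lam` is the normalized wavelength `Λ`. -/
def IsNormWavelength (b0 ψ : ℝ) (Lam : ℝ → ℝ) : Prop :=
  (∀ l : ℕ, 2 ≤ l → l ≤ lmidN ψ → Even l → Lam (l : ℝ) = lambdaMax b0 ψ l / (l : ℝ)) ∧
  (∀ l : ℕ, 4 ≤ l → l ≤ lmidN ψ → Even l → AffOn Lam (Set.Icc ((l : ℝ) - 2) (l : ℝ))) ∧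
  AffOn Lam (Set.Icc ((lmidN ψ : ℝ) - 2) (lmaxN ψ : ℝ))

/-- `y ∈ 𝒰^l_δ`, with associated configuration `ybar ∈ 𝒰^l`. -/
def AssocPerturb (b0 ψ δ : ℝ) (l : ℕ) (y ybar : ℕ → ℂ) : Prop :=
  Admissible (l + 1) y ∧ (∃ i₀ : ℕ, memU b0 ψ l i₀ ybar) ∧
  (∀ i : ℕ, 1 ≤ i → i ≤ l → |bnd y i - b0| ≤ δ) ∧
  (∀ i : ℕ, 2 ≤ i → i ≤ l → |ang y i - ang ybar i| ≤ δ)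

/-- `𝒜^δ_n`. -/
def AdmissiblePerturbed (b0 ψ δ : ℝ) (n : ℕ) (y : ℕ → ℂ) : Prop :=
  Admissible n y ∧ (∀ i : ℕ, 1 ≤ i → i + 1 ≤ n → |bnd y i - b0| ≤ δ) ∧
  (∀ i : ℕ, 2 ≤ i → i + 1 ≤ n → min |ang y i - (π + ψ)| |ang y i - (π - ψ)| ≤ δ)

/-- The property of the constant `c_mix` in the length estimate for odd atomic periods. -/
def MixConst (b0 ψ c : ℝ) : Prop :=
  ∀ l₁ l₂ : ℕ, Odd l₁ → Odd l₂ → 2 ≤ l₁ → l₁ ≤ lmaxN ψ → 2 ≤ l₂ → l₂ ≤ lmaxN ψ →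
    ∀ y : ℕ → ℂ,
      (∃ i₀ : ℕ, memU b0 ψ (l₁ + 1) i₀ y) →
      (∃ i₀ : ℕ, memU b0 ψ (l₂ - 1) i₀ (fun i => y (i + l₁ + 1))) →
      (∃ m : ℤ, ang y (l₁ + 2) - π = (2 * (m : ℝ) + 1) * ψ) →
      ‖y (l₁ + l₂ + 1) - y 1‖ ≤
        max (lambdaMax b0 ψ (l₁ + 1) + lambdaMax b0 ψ (l₂ - 1))
            (lambdaMax b0 ψ (l₁ - 1) + lambdaMax b0 ψ (l₂ + 1))
          - (if l₂ ≤ l₁ then c else 0)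

/-- `𝓘_sgn`. -/
def Isgn (n : ℕ) (y : ℕ → ℂ) : Finset ℕ :=
  ((Finset.Icc 3 (n - 2)).filter fun i => π < ang y i ∧ ang y (i + 1) < π) ∪ {1}

/-- `𝓘^l_sgn`. -/
def IsgnL (n : ℕ) (y : ℕ → ℂ) (l : ℕ) : Finset ℕ :=
  (Isgn n y).filter fun i =>
    (∀ k : ℕ, 1 ≤ k → k ≤ l - 1 → i + k ∉ Isgn n y) ∧ (i + l ∈ Isgn n y ∨ i + l = n)

/-- The maximal length of odd atomic periods `ℒ`. -/
def maxOddLength (ψ : ℝ) (Lam : ℝ → ℝ) (N S : ℕ) : ℝ :=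
  sSup { x : ℝ | ∃ r : ℕ → ℕ,
    (∀ l : ℕ, r l ≠ 0 → Even l ∧ 2 ≤ l ∧ l ≤ lmaxN ψ) ∧
    (∑ l ∈ Finset.Icc 2 (lmaxN ψ), r l) = N ∧
    (∑ l ∈ Finset.Icc 2 (lmaxN ψ), l * r l) = 2 * (S / 2) ∧
    x = ∑ l ∈ Finset.Icc 2 (lmaxN ψ), (r l : ℝ) * (l : ℝ) * Lam (l : ℝ) }

/-- The generalized cell energy. -/
def EgenCell (v₂ v₃ : ℝ → ℝ) (ρ ρ' : ℝ) (p q r s : ℂ) : ℝ :=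
  (Ecell v₂ v₃ ρ p q r + Ecell v₂ v₃ ρ q r s) / 2 + ρ' * v₂ ‖s - p‖

/-- The configurational (general) energy `E_n`. -/
def Egen (v₂ v₃ : ℝ → ℝ) (ρ ρ' : ℝ) (n : ℕ) (y : ℕ → ℂ) : ℝ :=
  Ered v₂ v₃ ρ n y + ρ' * ∑ i ∈ Finset.Icc 1 (n - 3), v₂ ‖y (i + 3) - y i‖

/-- The boundary condition `(y_n − y_1)·e₁ = (n−1)μ`. -/
def BC (n : ℕ) (μ : ℝ) (y : ℕ → ℂ) : Prop := (y n - y 1).re = ((n : ℝ) - 1) * μ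

/-- The minimal energy `E^{n,μ}_min`. -/
def Emin (v₂ v₃ : ℝ → ℝ) (ρ ρ' μ : ℝ) (n : ℕ) : ℝ :=
  sInf {E : ℝ | ∃ y : ℕ → ℂ, Admissible n y ∧ BC n μ y ∧ E = Egen v₂ v₃ ρ ρ' n y} /
    ((n : ℝ) - 2)

/-- `egen` is the common value `e^gen_cell`. -/
def IsEgenCellVal (v₂ v₃ : ℝ → ℝ) (ρ ρ' egen : ℝ) : Prop :=
  ∀ n : ℕ, ∀ y : ℕ → ℂ, MinimizesEred v₂ v₃ ρ n y →
    ∀ i : ℕ, 1 ≤ i → i + 3 ≤ n →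
      Real.sign (ang y (i + 1) - π) = Real.sign (ang y (i + 2) - π) →
        EgenCell v₂ v₃ ρ ρ' (y i) (y (i + 1)) (y (i + 2)) (y (i + 3)) = egen

/-- `eper` is the common value `e_per`. -/
def IsEperVal (v₂ v₃ : ℝ → ℝ) (ρ ρ' egen eper : ℝ) : Prop :=
  ∀ n : ℕ, ∀ y : ℕ → ℂ, MinimizesEred v₂ v₃ ρ n y →
    ∀ i : ℕ, 1 ≤ i → i + 3 ≤ n →
      Real.sign (ang y (i + 1) - π) ≠ Real.sign (ang y (i + 2) - π) →
        EgenCell v₂ v₃ ρ ρ' (y i) (y (i + 1)) (y (i + 2)) (y (i + 3)) = egen + ρ' * eper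

/-- `f` is piecewise affine on `s`. -/
def PiecewiseAffOn (f : ℝ → ℝ) (s : Set ℝ) : Prop :=
  ∃ P : Finset ℝ, ∀ a b : ℝ, a ∈ s → b ∈ s → a ≤ b → (∀ z ∈ P, z ∉ Set.Ioo a b) →
    AffOn f (Set.Icc a b ∩ s)

/-- The data `(e^gen_cell, e_range, c)` from the characterization of the minimal energy. -/
def EnergyChar (v₂ v₃ : ℝ → ℝ) (ρ ρ' m₁ m₂ egen : ℝ) (erange : ℝ → ℝ) (c : ℝ) : Prop :=
  0 < c ∧ StrictMonoOn erange (Set.Icc m₁ m₂) ∧ ConvexOn ℝ (Set.Icc m₁ m₂) erange ∧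
  PiecewiseAffOn erange (Set.Icc m₁ m₂) ∧
  ∀ μ ∈ Set.Icc m₁ m₂, ∀ n : ℕ, 3 ≤ n →
    |egen + ρ' * erange μ - Emin v₂ v₃ ρ ρ' μ n| ≤ c * (ρ' ^ 2 + 1 / (n : ℝ))

/-- The set of resonant lengths `M_res`. -/
def Mres (m₁ m₂ : ℝ) (erange : ℝ → ℝ) : Set ℝ :=
  {μ | μ ∈ Set.Icc m₁ m₂ ∧ ¬ DifferentiableWithinAt ℝ erange (Set.Icc m₁ m₂) μ}

/-- `𝒞(y)`, the set of atoms where the chain changes its curvature. -/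
def Cset (n : ℕ) (y : ℕ → ℂ) : Finset ℕ :=
  (Finset.Icc 2 (n - 2)).filter fun i => π < ang y i ∧ ang y (i + 1) < π

/-- `j` is the successor of `i` in `C`. -/
def SuccIn (C : Finset ℕ) (i j : ℕ) : Prop :=
  i ∈ C ∧ j ∈ C ∧ i < j ∧ ∀ k ∈ C, i < k → j ≤ k

/-- Almost minimizers of `E^{n,μ}_min`. -/
def AlmostMin (v₂ v₃ : ℝ → ℝ) (ρ ρ' μ c : ℝ) (n : ℕ) (y : ℕ → ℂ) : Prop :=
  Admissible n y ∧ BC n μ y ∧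
    Egen v₂ v₃ ρ ρ' n y / ((n : ℝ) - 2) ≤ Emin v₂ v₃ ρ ρ' μ n + c * (ρ' ^ 2 + 1 / (n : ℝ))

lemma semiconc {V : Type*} [NormedAddCommGroup V] [NormedSpace ℝ V] (P : V → ℝ) (x0 : V)
    (hP : ContDiffAt ℝ 2 P x0) :
    ∃ K : ℝ, 0 ≤ K ∧ ∃ r : ℝ, 0 < r ∧ ∀ m h : V, m + h ∈ Metric.ball x0 r →
      m - h ∈ Metric.ball x0 r → P m ≤ (P (m + h) + P (m - h)) / 2 + K * ‖h‖ ^ 2 := by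
  have h1 : ContDiffAt ℝ 1 (fderiv ℝ P) x0 := hP.fderiv_right (by norm_num)
  obtain ⟨K, t, ht, hK⟩ := h1.exists_lipschitzOnWith
  have h2 : ∀ᶠ y in nhds x0, DifferentiableAt ℝ P y := by
    filter_upwards [hP.eventually (by simp)] with y hy
    exact hy.differentiableAt (by simp)
  obtain ⟨r, hr, hball⟩ := Metric.eventually_nhds_iff_ball.1 (h2.and ht)
  refine ⟨K, K.2, r, hr, fun m h hp hm => ?_⟩
  have hmem : ∀ τ ∈ Set.Icc (-1 : ℝ) 1, m + τ • h ∈ Metric.ball x0 r := by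
    intro τ hτ
    have := (convex_ball x0 r) hp hm (a := (1 + τ) / 2) (b := (1 - τ) / 2)
      (by linarith [hτ.1]) (by linarith [hτ.2]) (by ring)
    convert this using 1
    module
  have hline : ∀ τ ∈ Set.Icc (0 : ℝ) 1, HasDerivWithinAt
      (fun τ : ℝ => P (m + τ • h) + P (m + (-τ) • h))
      (fderiv ℝ P (m + τ • h) h - fderiv ℝ P (m + (-τ) • h) h) (Set.Icc 0 1) τ := by
    intro τ hτ
    have e1 : HasDerivAt (fun τ : ℝ => m + τ • h) h τ := by
      simpa using ((hasDerivAt_id τ).smul_const h).const_add m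
    have e2 : HasDerivAt (fun τ : ℝ => m + (-τ) • h) (-h) τ := by
      simpa using ((hasDerivAt_id τ).neg.smul_const h).const_add m
    have d1 := (hball _ (hmem τ ⟨by linarith [hτ.1], hτ.2⟩)).1.hasFDerivAt.comp_hasDerivAt τ e1
    have d2 := (hball _ (hmem (-τ) ⟨by linarith [hτ.2], by linarith [hτ.1]⟩)).1.hasFDerivAt.comp_hasDerivAt τ e2
    have := (d1.add d2).hasDerivWithinAt (s := Set.Icc 0 1)
    refine HasDerivWithinAt.congr_deriv this ?_
    simp [sub_eq_add_neg]
  have := norm_image_sub_le_of_norm_deriv_le_segment_01' (C := 2 * K * ‖h‖ ^ 2) hline (by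
    intro τ hτ
    have l := hK.norm_sub_le (hball _ (hmem τ ⟨by linarith [hτ.1], hτ.2.le⟩)).2
      (hball _ (hmem (-τ) ⟨by linarith [hτ.2], by linarith [hτ.1]⟩)).2
    rw [← sub_apply]
    refine (ContinuousLinearMap.le_opNorm _ _).trans ?_
    have e : m + τ • h - (m + (-τ) • h) = (2 * τ) • h := by module
    rw [e, norm_smul, Real.norm_of_nonneg (by linarith [hτ.1])] at l
    have : (K : ℝ) * (2 * τ * ‖h‖) ≤ K * (2 * 1 * ‖h‖) := by
      have := hτ.2.le
      gcongr
    calc _ ≤ (K * (2 * 1 * ‖h‖)) * ‖h‖ := by gcongr; exact l.trans this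
      _ = _ := by ring)
  simp only [one_smul, neg_smul, zero_smul, neg_zero, add_zero, Real.norm_eq_abs] at this
  have := (abs_le.1 this).1
  rw [sub_eq_add_neg m h]
  linarith

lemma mid_of_convex {f : ℝ → ℝ} {D : Set ℝ} {c : ℝ}
    (h : ConvexOn ℝ D (fun x => f x - c * x ^ 2)) {x y : ℝ} (hx : x ∈ D) (hy : y ∈ D) :
    f ((x + y) / 2) ≤ (f x + f y) / 2 - c / 4 * (x - y) ^ 2 := by
  have := h.2 hx hy (show (0 : ℝ) ≤ 1 / 2 by norm_num) (show (0 : ℝ) ≤ 1 / 2 by norm_num) (by norm_num)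
  simp only [smul_eq_mul] at this
  rw [show 1 / 2 * x + 1 / 2 * y = (x + y) / 2 by ring] at this
  nlinarith

lemma iter_hasDerivAt {f : ℝ → ℝ} {s : Set ℝ} (hs : IsOpen s)
    (hf : ContDiffOn ℝ (⊤ : ℕ∞) f s) (k : ℕ) :
    ContDiffOn ℝ (⊤ : ℕ∞) (iteratedDeriv k f) s ∧
    ∀ x ∈ s, HasDerivAt (iteratedDeriv k f) (iteratedDeriv (k + 1) f x) x := by
  have h1 : ∀ k, ContDiffOn ℝ (⊤ : ℕ∞) (iteratedDeriv k f) s := by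
    intro k
    induction k with
    | zero => simpa using hf
    | succ k ih =>
      rw [iteratedDeriv_succ]
      exact ((contDiffOn_infty_iff_deriv_of_isOpen hs).1 ih).2
  refine ⟨h1 k, fun x hx => ?_⟩
  rw [iteratedDeriv_succ]
  exact ((((contDiffOn_infty_iff_deriv_of_isOpen hs).1 (h1 k)).1 x hx).differentiableAt
    (hs.mem_nhds hx)).hasDerivAt

lemma v2_conv_near {v₂ v₃ : ℝ → ℝ} (hp : PotentialPair v₂ v₃) :
    ∃ c > 0, ∃ δ > 0, δ ≤ 0.1 ∧ ∀ x ∈ Set.Icc (1 - δ) (1 + δ), ∀ y ∈ Set.Icc (1 - δ) (1 + δ),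
      v₂ ((x + y) / 2) ≤ (v₂ x + v₂ y) / 2 - c * (x - y) ^ 2 := by
  have H := iter_hasDerivAt isOpen_Ioi hp.v₂_smooth
  have hc : ContinuousAt (iteratedDeriv 2 v₂) 1 :=
    (H 2).1.continuousOn.continuousAt (Ioi_mem_nhds one_pos)
  have hpos := hp.v₂_conv
  set κ := iteratedDeriv 2 v₂ 1 with hκ
  have ev := hc.eventually (lt_mem_nhds (show κ / 2 < iteratedDeriv 2 v₂ 1 by linarith))
  obtain ⟨ε, hε, hb⟩ := Metric.eventually_nhds_iff.1 ev
  refine ⟨κ / 4 / 4, by positivity, min (ε / 2) 0.1, by positivity, min_le_right _ _, ?_⟩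
  set δ := min (ε / 2) 0.1
  have hδ1 : δ ≤ 0.1 := min_le_right _ _
  have hδ2 : δ ≤ ε / 2 := min_le_left _ _
  intro x hx y hy
  refine mid_of_convex (D := Set.Icc (1 - δ) (1 + δ)) ?_ hx hy
  have hd : ∀ x ∈ Set.Icc (1 - δ) (1 + δ), HasDerivAt (fun x => v₂ x - κ / 4 * x ^ 2)
      (iteratedDeriv 1 v₂ x - κ / 2 * x) x := by
    intro x hx
    have hx0 : x ∈ Set.Ioi (0 : ℝ) := by
      have := hx.1; norm_num at hδ1; simp; linarith
    have h1 := (H 0).2 x hx0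
    simp only [iteratedDeriv_zero] at h1
    refine (h1.sub ((hasDerivAt_pow 2 x).const_mul (κ / 4))).congr_deriv ?_
    push_cast; ring
  have hd2 : ∀ x ∈ Set.Icc (1 - δ) (1 + δ), HasDerivAt (fun x => iteratedDeriv 1 v₂ x - κ / 2 * x)
      (iteratedDeriv 2 v₂ x - κ / 2) x := by
    intro x hx
    have hx0 : x ∈ Set.Ioi (0 : ℝ) := by
      have := hx.1; norm_num at hδ1; simp; linarith
    have h1 := (H 1).2 x hx0
    refine (h1.sub ((hasDerivAt_id x).const_mul (κ / 2))).congr_deriv ?_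
    ring
  have mono : MonotoneOn (fun x => iteratedDeriv 1 v₂ x - κ / 2 * x) (Set.Icc (1 - δ) (1 + δ)) := by
    refine monotoneOn_of_deriv_nonneg (convex_Icc _ _)
      (fun x hx => (hd2 x hx).continuousAt.continuousWithinAt)
      (fun x hx => (hd2 x (interior_subset hx)).differentiableAt.differentiableWithinAt) ?_
    intro x hx
    have hx := interior_subset hx
    rw [(hd2 x hx).deriv]
    have : dist x 1 < ε := by
      rw [Real.dist_eq, abs_lt]; constructor <;> linarith [hx.1, hx.2]
    linarith [hb this]
  refine MonotoneOn.convexOn_of_deriv (convex_Icc _ _)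
      (fun x hx => (hd x hx).continuousAt.continuousWithinAt)
      (fun x hx => (hd x (interior_subset hx)).differentiableAt.differentiableWithinAt) ?_
  intro x hx y hy hxy
  rw [(hd x (interior_subset hx)).deriv, (hd y (interior_subset hy)).deriv]
  exact mono (interior_subset hx) (interior_subset hy) hxy

lemma nonneg_of_der {h h' : ℝ → ℝ} {η : ℝ} (h0 : h 0 = 0)
    (hd : ∀ t ∈ Set.Icc 0 η, HasDerivAt h (h' t) t) (hn : ∀ t ∈ Set.Icc 0 η, 0 ≤ h' t) :
    ∀ t ∈ Set.Icc 0 η, 0 ≤ h t := by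
  have : MonotoneOn h (Set.Icc 0 η) := by
    refine monotoneOn_of_deriv_nonneg (convex_Icc _ _)
      (fun x hx => (hd x hx).continuousAt.continuousWithinAt)
      (fun x hx => (hd x (interior_subset hx)).differentiableAt.differentiableWithinAt) ?_
    intro x hx
    rw [(hd x (interior_subset hx)).deriv]
    exact hn x (interior_subset hx)
  intro t ht
  have := this ⟨le_rfl, ht.1.trans ht.2⟩ ht ht.1
  linarith

/-- three-body potential as a function of `s = 1 - cos t`. -/
def gE (v₃ : ℝ → ℝ) (s : ℝ) : ℝ := v₃ (π + arccos (1 - s))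

lemma gE_conv_near {v₂ v₃ : ℝ → ℝ} (hp : PotentialPair v₂ v₃) :
    ∃ c > 0, ∃ δ > 0, δ ≤ 0.1 ∧ ∀ x ∈ Set.Icc 0 δ, ∀ y ∈ Set.Icc 0 δ,
      gE v₃ ((x + y) / 2) ≤ (gE v₃ x + gE v₃ y) / 2 - c * (x - y) ^ 2 := by
  have H := iter_hasDerivAt (s := Set.Ioo 0 (2 * π)) isOpen_Ioo
    (hp.v₃_smooth.mono Set.Ioo_subset_Icc_self)
  have hπ := Real.pi_pos
  have hc : ContinuousAt (iteratedDeriv 4 v₃) π :=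
    (H 4).1.continuousOn.continuousAt (Ioo_mem_nhds hπ (by linarith))
  have hpos := hp.v₃_d4
  set κ := iteratedDeriv 4 v₃ π / 2 with hκ
  have hκ0 : 0 < κ := by positivity
  have ev := hc.eventually (lt_mem_nhds (show κ < iteratedDeriv 4 v₃ π by linarith))
  obtain ⟨ε, hε, hb⟩ := Metric.eventually_nhds_iff.1 ev
  set F : ℕ → ℝ → ℝ := fun k t => iteratedDeriv k v₃ (π + t) with hF
  have hFd : ∀ k, ∀ t ∈ Set.Ico 0 π, HasDerivAt (F k) (F (k + 1) t) t := by
    intro k t ht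
    exact ((H k).2 (π + t) ⟨by linarith [ht.1], by linarith [ht.2]⟩).comp_const_add π t
  have F1 : F 1 0 = 0 := by simp [hF, hp.v₃_d1]
  have F2 : F 2 0 = 0 := by simp [hF, hp.v₃_d2]
  have F3 : F 3 0 = 0 := by simp [hF, hp.v₃_d3]
  set η := min (ε / 2) 1 with hη
  have hη0 : 0 < η := by positivity
  have hη1 : η ≤ 1 := min_le_right _ _
  have hη2 : η ≤ ε / 2 := min_le_left _ _
  have hπ3 := Real.pi_gt_three
  have hsub : ∀ t ∈ Set.Icc 0 η, t ∈ Set.Ico 0 π := fun t ht => ⟨ht.1, by linarith [ht.2]⟩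
  have hF4 : ∀ t ∈ Set.Icc 0 η, κ ≤ F 4 t := by
    intro t ht
    have : dist (π + t) π < ε := by
      rw [Real.dist_eq, add_sub_cancel_left, abs_of_nonneg ht.1]; linarith [ht.2]
    exact (hb this).le
  have hF3 : ∀ t ∈ Set.Icc 0 η, 0 ≤ F 3 t - κ * t :=
    nonneg_of_der (h' := fun t => F 4 t - κ) (by simp [F3])
      (fun t ht => ((hFd 3 t (hsub t ht)).sub ((hasDerivAt_id t).const_mul κ)).congr_deriv (by simp))
      (fun t ht => by linarith [hF4 t ht])
  have hF2 : ∀ t ∈ Set.Icc 0 η, 0 ≤ F 2 t :=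
    nonneg_of_der (h' := F 3) F2 (fun t ht => hFd 2 t (hsub t ht))
      (fun t ht => by nlinarith [hF3 t ht, ht.1])
  have hF1 : ∀ t ∈ Set.Icc 0 η, 0 ≤ F 1 t :=
    nonneg_of_der (h' := F 2) F1 (fun t ht => hFd 1 t (hsub t ht)) hF2
  set c := κ / 6 with hcdef
  have hc0 : 0 < c := by positivity
  have hN : ∀ t ∈ Set.Icc 0 η, 0 ≤ F 2 t * sin t - F 1 t * cos t - 2 * c * sin t ^ 3 := by
    refine nonneg_of_der (h' := fun t => sin t * (F 3 t + F 1 t - 6 * c * (sin t * cos t)))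
      (by simp [F1]) (fun t ht => ?_) (fun t ht => ?_)
    · have := (((hFd 2 t (hsub t ht)).mul (Real.hasDerivAt_sin t)).sub
        ((hFd 1 t (hsub t ht)).mul (Real.hasDerivAt_cos t))).sub
        (((Real.hasDerivAt_sin t).pow 3).const_mul (2 * c))
      refine this.congr_deriv ?_
      push_cast; ring
    · have hs0 : 0 ≤ sin t := Real.sin_nonneg_of_nonneg_of_le_pi ht.1 (by linarith [ht.2])
      have hst : sin t ≤ t := Real.sin_le ht.1
      have hsc : sin t * cos t ≤ t := by nlinarith [Real.cos_le_one t]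
      have : 6 * c * (sin t * cos t) ≤ κ * t := by
        rw [hcdef]
        have := mul_le_mul_of_nonneg_left hsc hκ0.le
        linarith
      apply mul_nonneg hs0
      linarith [hF3 t ht, hF1 t ht]
  have hsin : ∀ t ∈ Set.Ioo 0 η, 0 < sin t := fun t ht =>
    Real.sin_pos_of_pos_of_lt_pi ht.1 (by linarith [ht.2])
  have hM : MonotoneOn (fun t => F 1 t / sin t - 2 * c * (1 - cos t)) (Set.Ioo 0 η) := by
    have hd : ∀ t ∈ Set.Ioo 0 η, HasDerivAt (fun t => F 1 t / sin t - 2 * c * (1 - cos t))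
        ((F 2 t * sin t - F 1 t * cos t - 2 * c * sin t ^ 3) / sin t ^ 2) t := by
      intro t ht
      have := ((hFd 1 t (hsub t (Set.Ioo_subset_Icc_self ht))).div (Real.hasDerivAt_sin t)
        (hsin t ht).ne').sub (((Real.hasDerivAt_cos t).const_sub 1).const_mul (2 * c))
      refine this.congr_deriv ?_
      have := (hsin t ht).ne'
      field_simp
    refine monotoneOn_of_deriv_nonneg (convex_Ioo _ _)
      (fun x hx => (hd x hx).continuousAt.continuousWithinAt)
      (fun x hx => (hd x (interior_subset hx)).differentiableAt.differentiableWithinAt) ?_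
    intro x hx
    have hx := interior_subset hx
    rw [(hd x hx).deriv]
    exact div_nonneg (hN x (Set.Ioo_subset_Icc_self hx)) (by positivity)
  set δ := min (1 - cos η) 0.1 with hδ
  have hcosη : cos η < 1 := by
    have := Real.cos_lt_cos_of_nonneg_of_le_pi le_rfl (by linarith) hη0
    simpa using this
  have hδ0 : 0 < δ := lt_min (by linarith) (by norm_num)
  have hδ1 : δ ≤ 1 - cos η := min_le_left _ _
  have hδ2 : δ ≤ 0.1 := min_le_right _ _
  norm_num at hδ2
  refine ⟨c / 4, by positivity, δ, hδ0, min_le_right _ _, ?_⟩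
  intro x hx y hy
  refine mid_of_convex (D := Set.Icc 0 δ) ?_ hx hy
  have harc : ∀ s ∈ Set.Ioo 0 δ, arccos (1 - s) ∈ Set.Ioo 0 η := by
    intro s hs
    refine ⟨Real.arccos_pos.2 (by linarith [hs.1]), ?_⟩
    have := Real.arccos_lt_arccos (x := cos η) (y := 1 - s) (Real.neg_one_le_cos _) (by linarith [hs.2]) (by linarith [hs.1])
    rwa [Real.arccos_cos hη0.le (by linarith)] at this
  have hd : ∀ s ∈ Set.Ioo 0 δ, HasDerivAt (fun s => gE v₃ s - c * s ^ 2)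
      ((fun t => F 1 t / sin t - 2 * c * (1 - cos t)) (arccos (1 - s))) s := by
    intro s hs
    have ht := harc s hs
    have h0 := hFd 0 _ (hsub _ (Set.Ioo_subset_Icc_self ht))
    have ha : HasDerivAt arccos (-(1 / √(1 - (1 - s) ^ 2))) (1 - s) :=
      Real.hasDerivAt_arccos (by linarith [hs.2]) (by linarith [hs.1])
    have hb := h0.comp s (ha.comp s ((hasDerivAt_id s).const_sub 1))
    have hfun : (fun s => gE v₃ s - c * s ^ 2) =
        (F 0 ∘ arccos ∘ HSub.hSub 1) - fun y => c * y ^ 2 := by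
      ext s; simp [gE, hF]
    rw [hfun]
    refine (hb.sub ((hasDerivAt_pow 2 s).const_mul c)).congr_deriv ?_
    · change _ = F 1 (arccos (1 - s)) / sin (arccos (1 - s)) - 2 * c * (1 - cos (arccos (1 - s)))
      rw [← Real.sin_arccos, Real.cos_arccos (by linarith [hs.2]) (by linarith [hs.1])]
      have := (hsin _ ht).ne'
      push_cast
      field_simp
      ring
  refine MonotoneOn.convexOn_of_deriv (convex_Icc _ _) ?_ ?_ ?_
  · have h3 : ContinuousOn (gE v₃) (Set.Icc 0 δ) := by
      refine hp.v₃_smooth.continuousOn.comp (t := Set.Icc 0 (2 * π)) (f := fun s => π + arccos (1 - s)) ?_ ?_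
      · exact (continuous_const.add (Real.continuous_arccos.comp (continuous_const.sub continuous_id))).continuousOn
      · intro s hs
        exact ⟨by linarith [Real.arccos_nonneg (1 - s)], by linarith [Real.arccos_le_pi (1 - s)]⟩
    exact h3.sub (by fun_prop)
  · rw [interior_Icc]
    exact fun x hx => (hd x hx).differentiableAt.differentiableWithinAt
  · rw [interior_Icc]
    intro x hx y hy hxy
    rw [(hd x hx).deriv, (hd y hy).deriv]
    exact hM (harc x hx) (harc y hy) (Real.arccos_le_arccos (by linarith))

/-- third-neighbour-free part: next-to-nearest distance. -/
def dE (a b s : ℝ) : ℝ := √(a ^ 2 + b ^ 2 + 2 * a * b * (1 - s))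

/-- cell energy in the variables bond lengths and `s = 1 - cos t`. -/
def FE (v₂ v₃ : ℝ → ℝ) (ρ a b s : ℝ) : ℝ := v₂ a + v₂ b + gE v₃ s + ρ * v₂ (dE a b s)

lemma gE_cont {v₂ v₃ : ℝ → ℝ} (hp : PotentialPair v₂ v₃) : Continuous (gE v₃) := by
  have hπ := Real.pi_pos
  refine hp.v₃_smooth.continuousOn.comp_continuous (s := Set.Icc 0 (2 * π))
    (f := fun s => π + arccos (1 - s)) ?_ ?_
  · exact (continuous_const.add (Real.continuous_arccos.comp (continuous_const.sub continuous_id)))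
  · intro s
    exact ⟨by linarith [Real.arccos_nonneg (1 - s)], by linarith [Real.arccos_le_pi (1 - s)]⟩

lemma gE_nonneg {v₂ v₃ : ℝ → ℝ} (hp : PotentialPair v₂ v₃) (s : ℝ) : 0 ≤ gE v₃ s :=
  hp.v₃_nonneg _ ⟨by linarith [Real.arccos_nonneg (1 - s), Real.pi_pos],
    by linarith [Real.arccos_le_pi (1 - s)]⟩

lemma gE_zero {v₂ v₃ : ℝ → ℝ} (hp : PotentialPair v₂ v₃) : gE v₃ 0 = 0 := by
  simp [gE, hp.v₃_min]

lemma gE_pos {v₂ v₃ : ℝ → ℝ} (hp : PotentialPair v₂ v₃) {s : ℝ} (hs : 0 < s) : 0 < gE v₃ s := by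
  have : 0 < arccos (1 - s) := Real.arccos_pos.2 (by linarith)
  exact hp.v₃_min_unique _ ⟨by linarith [Real.pi_pos],
    by linarith [Real.arccos_le_pi (1 - s)]⟩ (by linarith)

lemma gE_gap {v₂ v₃ : ℝ → ℝ} (hp : PotentialPair v₂ v₃) {δ : ℝ} (hδ : 0 < δ) :
    ∃ γ > 0, ∀ s ∈ Set.Icc δ 2, γ ≤ gE v₃ s := by
  by_cases h2 : δ ≤ 2
  · obtain ⟨s0, hs0, hmin⟩ := (isCompact_Icc (a := δ) (b := (2 : ℝ))).exists_isMinOn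
      ⟨δ, le_rfl, h2⟩ (gE_cont hp).continuousOn
    exact ⟨_, gE_pos hp (hδ.trans_le hs0.1), fun s hs => hmin hs⟩
  · exact ⟨1, one_pos, fun s hs => absurd (hs.1.trans hs.2) h2⟩

lemma v2_gap {v₂ v₃ : ℝ → ℝ} (hp : PotentialPair v₂ v₃) {δ : ℝ} (hδ : 0 < δ) (hδ1 : δ ≤ 0.1) :
    ∃ γ > 0, ∀ b : ℝ, 0.4 ≤ b → δ ≤ |b - 1| → γ ≤ v₂ b + 1 := by
  norm_num at hδ1
  have hc : ContinuousOn v₂ (Set.Icc 0.4 (1 - δ)) := hp.v₂_smooth.continuousOn.mono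
    (fun x hx => lt_of_lt_of_le (by norm_num) hx.1)
  obtain ⟨b0, hb0, hmin⟩ := isCompact_Icc.exists_isMinOn
      ⟨1 - δ, by norm_num; linarith, le_rfl⟩ hc
  have h1 : v₂ 1 < v₂ b0 := hp.v₂_min_unique b0 (lt_of_lt_of_le (by norm_num) hb0.1)
    (by linarith [hb0.2])
  have h2 : v₂ 1 < v₂ (1 + δ) := hp.v₂_min_unique _ (by simp; linarith) (by linarith)
  rw [hp.v₂_min] at h1 h2
  refine ⟨min (v₂ b0 + 1) (v₂ (1 + δ) + 1), lt_min (by linarith) (by linarith), ?_⟩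
  intro b hb hbd
  rcases le_abs'.1 hbd with h | h
  · have : v₂ b0 ≤ v₂ b := hmin ⟨hb, by linarith⟩
    exact (min_le_left _ _).trans (by linarith)
  · have : v₂ (1 + δ) ≤ v₂ b := hp.v₂_mono.monotoneOn (by simp; linarith) (by simp; linarith)
      (by linarith)
    exact (min_le_right _ _).trans (by linarith)

lemma norm_half_sq (x y z : ℝ) :
    ‖((x / 2, y / 2, z / 2) : ℝ × ℝ × ℝ)‖ ^ 2 ≤ x ^ 2 + y ^ 2 + z ^ 2 := by
  simp only [Prod.norm_def, Real.norm_eq_abs]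
  have q1 := sq_nonneg x
  have q2 := sq_nonneg y
  have q3 := sq_nonneg z
  rcases max_choice |x / 2| (max |y / 2| |z / 2|) with e | e <;> rw [e]
  · rw [sq_abs, div_pow]; linarith
  · rcases max_choice |y / 2| |z / 2| with e | e <;> rw [e, sq_abs, div_pow] <;> linarith

set_option maxHeartbeats 2000000 in
lemma cell_structure {v₂ v₃ : ℝ → ℝ} (hp : PotentialPair v₂ v₃) :
    ∃ ρ₀ : ℝ, 0 < ρ₀ ∧ ∀ ρ : ℝ, 0 < ρ → ρ ≤ ρ₀ → ∃ b0 s0 : ℝ, 0.9 ≤ b0 ∧ b0 ≤ 1.1 ∧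
      0 ≤ s0 ∧ s0 ≤ 0.1 ∧ ∀ a b s : ℝ, 0 < a → a ≤ 1.5 → 0 < b → b ≤ 1.5 → 1.5 < a + b →
        0 ≤ s → s ≤ 2 → 0 < dE a b s → FE v₂ v₃ ρ b0 b0 s0 ≤ FE v₂ v₃ ρ a b s ∧
        (FE v₂ v₃ ρ a b s = FE v₂ v₃ ρ b0 b0 s0 → a = b0 ∧ b = b0 ∧ s = s0) := by
  obtain ⟨c2, hc2, δ2, hδ2, hδ2', H2⟩ := v2_conv_near hp
  obtain ⟨c3, hc3, δ3, hδ3, hδ3', H3⟩ := gE_conv_near hp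
  have hPd : ContDiffAt ℝ 2 (fun x : ℝ × ℝ × ℝ => v₂ (dE x.1 x.2.1 x.2.2)) (1, 1, 0) := by
    have e : dE 1 1 0 = 2 := by
      rw [dE, show (1 : ℝ) ^ 2 + 1 ^ 2 + 2 * 1 * 1 * (1 - 0) = 2 ^ 2 by norm_num,
        Real.sqrt_sq (by norm_num)]
    have hv : ContDiffAt ℝ 2 v₂ (dE 1 1 0) :=
      (hp.v₂_smooth.contDiffAt (by rw [e]; exact Ioi_mem_nhds two_pos)).of_le (show ((2 : ℕ∞) : WithTop ℕ∞) ≤ _ from WithTop.coe_le_coe.2 le_top)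
    have hd : ContDiffAt ℝ 2 (fun x : ℝ × ℝ × ℝ => dE x.1 x.2.1 x.2.2) (1, 1, 0) := by
      unfold dE
      refine ContDiffAt.sqrt (by fun_prop) (by norm_num)
    exact ContDiffAt.comp (g := v₂) (f := fun x : ℝ × ℝ × ℝ => dE x.1 x.2.1 x.2.2) (1, 1, 0) hv hd
  obtain ⟨K, hK, r, hr, HP⟩ := semiconc _ _ hPd
  set δ := min (min δ2 δ3) (r / 2) with hδ
  have hδ0 : 0 < δ := by positivity
  have hδr : δ ≤ r / 2 := min_le_right _ _
  have hδl : δ ≤ δ2 := (min_le_left _ _).trans (min_le_left _ _)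
  have hδm : δ ≤ δ3 := (min_le_left _ _).trans (min_le_right _ _)
  have hδ01 : δ ≤ 0.1 := hδl.trans hδ2'
  have hδ01' : δ ≤ 1 / 10 := by norm_num at hδ01; exact hδ01
  obtain ⟨γ2, hγ2, G2⟩ := v2_gap hp hδ0 hδ01
  obtain ⟨γ3, hγ3, G3⟩ := gE_gap hp hδ0
  set γ := min γ2 γ3 with hγ
  have hγ0 : 0 < γ := lt_min hγ2 hγ3
  have hv22 : -1 ≤ v₂ 2 := hp.v₂_lb 2 (by simp)
  set c := min c2 c3 with hc
  have hc0 : 0 < c := lt_min hc2 hc3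
  refine ⟨min (c / (K + 1)) (γ / (v₂ 2 + 2)), lt_min (by positivity)
    (div_pos hγ0 (by linarith)), fun ρ hρ hρ0 => ?_⟩
  have hρ1 : ρ * (K + 1) ≤ c := (le_div_iff₀ (by linarith)).1 (hρ0.trans (min_le_left _ _))
  have hρ2 : ρ * (v₂ 2 + 2) ≤ γ := (le_div_iff₀ (by linarith)).1 (hρ0.trans (min_le_right _ _))
  set B : Set (ℝ × ℝ × ℝ) := Set.Icc (1 - δ) (1 + δ) ×ˢ Set.Icc (1 - δ) (1 + δ) ×ˢ Set.Icc 0 δ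
    with hB
  have hBc : IsCompact B := isCompact_Icc.prod (isCompact_Icc.prod isCompact_Icc)
  have hBdE : ∀ x ∈ B, 0 < dE x.1 x.2.1 x.2.2 := by
    rintro ⟨a, b, s⟩ ⟨ha, hb, hs⟩
    apply Real.sqrt_pos.2
    simp only [Set.mem_Icc] at ha hb hs ⊢
    have h1 : 0 < a := by linarith
    have h2 : 0 < b := by linarith
    have h3 : 0 < 1 - s := by linarith
    positivity
  have hcont : ContinuousOn (fun x : ℝ × ℝ × ℝ => FE v₂ v₃ ρ x.1 x.2.1 x.2.2) B := by
    have hv := hp.v₂_smooth.continuousOn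
    unfold FE
    refine ((ContinuousOn.add ?_ ?_).add ?_).add (continuousOn_const.mul ?_)
    · exact hv.comp continuous_fst.continuousOn fun x hx => by
        have := hx.1.1; simp; linarith
    · exact hv.comp (continuous_fst.comp continuous_snd).continuousOn fun x hx => by
        have := hx.2.1.1; simp; linarith
    · exact ((gE_cont hp).comp (continuous_snd.comp continuous_snd)).continuousOn
    · refine hv.comp (f := fun x : ℝ × ℝ × ℝ => dE x.1 x.2.1 x.2.2) ?_ hBdE
      unfold dE
      fun_prop
  have h110 : ((1, 1, 0) : ℝ × ℝ × ℝ) ∈ B := by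
    simp [hB, hδ0.le]
  obtain ⟨⟨a0, b0, s0⟩, hx0, hmin⟩ := hBc.exists_isMinOn ⟨_, h110⟩ hcont
  have hmin' : ∀ a b s, (a, b, s) ∈ B → FE v₂ v₃ ρ a0 b0 s0 ≤ FE v₂ v₃ ρ a b s :=
    fun a b s h => hmin h
  have hball : ∀ x ∈ B, x ∈ Metric.ball ((1, 1, 0) : ℝ × ℝ × ℝ) r := by
    rintro ⟨a, b, s⟩ ⟨ha, hb, hs⟩
    simp only [Set.mem_Icc] at ha hb hs
    simp only [Metric.mem_ball, Prod.dist_eq, Real.dist_eq, max_lt_iff, abs_lt]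
    refine ⟨⟨?_, ?_⟩, ⟨?_, ?_⟩, ?_, ?_⟩ <;> linarith
  have huniq : ∀ a b s, (a, b, s) ∈ B → FE v₂ v₃ ρ a b s = FE v₂ v₃ ρ a0 b0 s0 →
      a = a0 ∧ b = b0 ∧ s = s0 := by
    intro a b s h hE
    have hmB : ((a + a0) / 2, (b + b0) / 2, (s + s0) / 2) ∈ B := by
      obtain ⟨ha, hb, hs⟩ := h
      obtain ⟨ha0, hb0, hs0⟩ := hx0
      simp only [Set.mem_Icc] at ha hb hs ha0 hb0 hs0
      refine ⟨⟨?_, ?_⟩, ⟨?_, ?_⟩, ?_, ?_⟩ <;> simp only <;> linarith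
    have hm := hmin' _ _ _ hmB
    have hsub2 : ∀ z ∈ Set.Icc (1 - δ) (1 + δ), z ∈ Set.Icc (1 - δ2) (1 + δ2) :=
      fun z hz => ⟨by linarith [hz.1], by linarith [hz.2]⟩
    have hsub3 : ∀ z ∈ Set.Icc 0 δ, z ∈ Set.Icc 0 δ3 :=
      fun z hz => ⟨hz.1, by linarith [hz.2]⟩
    have i1 := H2 a (hsub2 _ h.1) a0 (hsub2 _ hx0.1)
    have i2 := H2 b (hsub2 _ h.2.1) b0 (hsub2 _ hx0.2.1)
    have i3 := H3 s (hsub3 _ h.2.2) s0 (hsub3 _ hx0.2.2)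
    have i4 := HP ((a + a0) / 2, (b + b0) / 2, (s + s0) / 2)
      ((a - a0) / 2, (b - b0) / 2, (s - s0) / 2)
      (by convert hball _ h using 1; ext <;> simp <;> ring)
      (by convert hball _ hx0 using 1; ext <;> simp <;> ring)
    simp only [Prod.mk_add_mk, Prod.mk_sub_mk] at i4
    rw [show (a + a0) / 2 + (a - a0) / 2 = a by ring, show (b + b0) / 2 + (b - b0) / 2 = b by ring,
      show (s + s0) / 2 + (s - s0) / 2 = s by ring, show (a + a0) / 2 - (a - a0) / 2 = a0 by ring,
      show (b + b0) / 2 - (b - b0) / 2 = b0 by ring, show (s + s0) / 2 - (s - s0) / 2 = s0 by ring]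
      at i4
    have hnorm : ‖(((a - a0) / 2, (b - b0) / 2, (s - s0) / 2) : ℝ × ℝ × ℝ)‖ ^ 2 ≤
        ((a - a0) ^ 2 + (b - b0) ^ 2 + (s - s0) ^ 2) := norm_half_sq _ _ _
    set D := (a - a0) ^ 2 + (b - b0) ^ 2 + (s - s0) ^ 2 with hD
    have hD0 : 0 ≤ D := by positivity
    have j1 : c * D ≤ c2 * (a - a0) ^ 2 + c2 * (b - b0) ^ 2 + c3 * (s - s0) ^ 2 := by
      have k2 : c ≤ c2 := min_le_left _ _
      have k3 : c ≤ c3 := min_le_right _ _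
      have := mul_le_mul_of_nonneg_right k2 (sq_nonneg (a - a0))
      have := mul_le_mul_of_nonneg_right k2 (sq_nonneg (b - b0))
      have := mul_le_mul_of_nonneg_right k3 (sq_nonneg (s - s0))
      rw [hD]; linarith
    have j2 := mul_le_mul_of_nonneg_left (i4.trans (add_le_add_right (mul_le_mul_of_nonneg_left hnorm hK) _)) hρ.le
    have j3 := mul_le_mul_of_nonneg_right hρ1 hD0
    unfold FE at hm hE
    have hDz : ρ * D ≤ 0 := by
      clear_value D c B γ δ
      linarith
    have hDz : D = 0 := le_antisymm (le_of_mul_le_mul_left (by simpa using hDz) hρ) hD0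
    have q1 := sq_nonneg (a - a0)
    have q2 := sq_nonneg (b - b0)
    have q3 := sq_nonneg (s - s0)
    refine ⟨?_, ?_, ?_⟩ <;> apply sub_eq_zero.1 <;> apply pow_eq_zero_iff (two_ne_zero) |>.1 <;> linarith
  have hsymm : ∀ a b s, FE v₂ v₃ ρ a b s = FE v₂ v₃ ρ b a s := by
    intro a b s
    unfold FE dE
    rw [show a ^ 2 + b ^ 2 + 2 * a * b * (1 - s) = b ^ 2 + a ^ 2 + 2 * b * a * (1 - s) by ring]
    ring
  have hab : b0 = a0 := (huniq b0 a0 s0 ⟨hx0.2.1, hx0.1, hx0.2.2⟩ (hsymm _ _ _)).1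
  rw [hab] at hmin' huniq
  have h1 := hx0.1
  have h3 := hx0.2.2
  simp only [Set.mem_Icc] at h1 h3
  refine ⟨a0, s0, by norm_num; linarith, by norm_num; linarith, h3.1, by norm_num; linarith, ?_⟩
  intro a b s ha ha' hb hb' hsum hs hs' hd
  by_cases hin : (a, b, s) ∈ B
  · exact ⟨hmin' a b s hin, huniq a b s hin⟩
  · have hlt : FE v₂ v₃ ρ a0 a0 s0 < FE v₂ v₃ ρ a b s := by
      have e0 := hmin' _ _ _ h110
      have e : dE 1 1 0 = 2 := by
        rw [dE, show (1 : ℝ) ^ 2 + 1 ^ 2 + 2 * 1 * 1 * (1 - 0) = 2 ^ 2 by norm_num,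
          Real.sqrt_sq (by norm_num)]
      refine lt_of_le_of_lt e0 ?_
      have la := hp.v₂_lb a ha
      have lb := hp.v₂_lb b hb
      have lg := gE_nonneg hp s
      have ld := mul_le_mul_of_nonneg_left (hp.v₂_lb _ hd) hρ.le
      unfold FE
      rw [e, gE_zero hp, hp.v₂_min]
      have hga : γ ≤ γ2 := min_le_left _ _
      have hgb : γ ≤ γ3 := min_le_right _ _
      have key : γ ≤ v₂ a + 1 + (v₂ b + 1) + gE v₃ s := by
        norm_num at hsum ha' hb'
        by_cases sa : a < 0.4
        · have := G2 b (by norm_num at *; linarith) (by norm_num at sa; rw [le_abs]; left; linarith)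
          linarith
        by_cases sb : b < 0.4
        · have := G2 a (by norm_num at *; linarith) (by norm_num at sb; rw [le_abs]; left; linarith)
          linarith
        by_cases ta : δ ≤ |a - 1|
        · linarith [G2 a (not_lt.1 sa) ta]
        by_cases tb : δ ≤ |b - 1|
        · linarith [G2 b (not_lt.1 sb) tb]
        by_cases ts : δ ≤ s
        · linarith [G3 s ⟨ts, hs'⟩]
        exfalso
        apply hin
        rw [not_le, abs_lt] at ta tb
        rw [not_le] at ts
        refine ⟨⟨?_, ?_⟩, ⟨?_, ?_⟩, ?_, ?_⟩ <;> simp only <;> linarith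
      linarith
    exact ⟨hlt.le, fun h => absurd h hlt.ne'⟩

lemma v3_ccw {v₂ v₃ : ℝ → ℝ} (hp : PotentialPair v₂ v₃) (a b : ℂ) (ha : a ≠ 0) (hb : b ≠ 0) :
    v₃ (ccwAngle a b) = v₃ (π + arccos (-((b * (starRingEnd ℂ) a).re / (‖a‖ * ‖b‖)))) := by
  set z := b * (starRingEnd ℂ) a with hz
  have hz0 : z ≠ 0 := mul_ne_zero hb (by simpa using ha)
  have hn : ‖z‖ = ‖a‖ * ‖b‖ := by rw [hz, norm_mul, RCLike.norm_conj, mul_comm]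
  have hcos : cos (ccwAngle a b) = z.re / (‖a‖ * ‖b‖) := by
    rw [← hn, ← Complex.cos_arg hz0]
    unfold ccwAngle
    split_ifs
    · rw [Real.cos_add_two_pi]
    · rfl
  have hpi := Real.pi_pos
  have hrange : 0 ≤ ccwAngle a b ∧ ccwAngle a b ≤ 2 * π := by
    unfold ccwAngle
    have h1 := Complex.neg_pi_lt_arg z
    have h2 := Complex.arg_le_pi z
    split_ifs with h
    · exact ⟨by linarith, by linarith⟩
    · exact ⟨not_lt.1 h, by linarith⟩
  rw [← hcos]
  set φ := ccwAngle a b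
  have : arccos (-cos φ) = |φ - π| := by
    rw [← Real.cos_sub_pi, ← Real.cos_abs, Real.arccos_cos (abs_nonneg _)]
    rw [abs_le]; constructor <;> linarith
  rw [this]
  rcases le_total φ π with h | h
  · rw [abs_of_nonpos (by linarith), ← hp.v₃_symm]; congr 1; ring
  · rw [abs_of_nonneg (by linarith)]; congr 1; ring

lemma norm_add_sqrt (u w : ℂ) :
    ‖u + w‖ ^ 2 = ‖u‖ ^ 2 + ‖w‖ ^ 2 + 2 * (w * (starRingEnd ℂ) u).re := by
  simp only [← Complex.normSq_eq_norm_sq, Complex.normSq_apply]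
  simp
  ring

lemma cell_eq {v₂ v₃ : ℝ → ℝ} (hp : PotentialPair v₂ v₃) (ρ : ℝ) (p q r : ℂ)
    (h1 : q - p ≠ 0) (h2 : r - q ≠ 0) :
    Ecell v₂ v₃ ρ p q r = FE v₂ v₃ ρ ‖q - p‖ ‖r - q‖
      (1 - ((r - q) * (starRingEnd ℂ) (q - p)).re / (‖q - p‖ * ‖r - q‖)) ∧
    ‖r - p‖ = dE ‖q - p‖ ‖r - q‖
      (1 - ((r - q) * (starRingEnd ℂ) (q - p)).re / (‖q - p‖ * ‖r - q‖)) := by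
  have n1 : ‖q - p‖ ≠ 0 := by simpa using h1
  have n2 : ‖r - q‖ ≠ 0 := by simpa using h2
  have hd : ‖r - p‖ = dE ‖q - p‖ ‖r - q‖
      (1 - ((r - q) * (starRingEnd ℂ) (q - p)).re / (‖q - p‖ * ‖r - q‖)) := by
    unfold dE
    rw [← Real.sqrt_sq (norm_nonneg (r - p)), show r - p = (q - p) + (r - q) by ring,
      norm_add_sqrt]
    congr 1
    field_simp
    ring
  refine ⟨?_, hd⟩
  have hv := v3_ccw hp (r - q) (p - q) h2 (sub_ne_zero.2 (Ne.symm (sub_ne_zero.1 h1)))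
  unfold Ecell FE gE
  rw [← hd, hv]
  have : -(((p - q) * (starRingEnd ℂ) (r - q)).re / (‖r - q‖ * ‖p - q‖)) =
      1 - (1 - ((r - q) * (starRingEnd ℂ) (q - p)).re / (‖q - p‖ * ‖r - q‖)) := by
    rw [norm_sub_rev p q, mul_comm ‖r - q‖]
    have e : ((p - q) * (starRingEnd ℂ) (r - q)).re = - ((r - q) * (starRingEnd ℂ) (q - p)).re := by
      simp; ring
    rw [e]; ring
  rw [this]

lemma sign_ang (a v : ℂ) (h : 0 < (v * (starRingEnd ℂ) (-a)).re) :
    Real.sign (ccwAngle a v - π) = Real.sign ((v * (starRingEnd ℂ) (-a)).im) := by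
  set z := v * (starRingEnd ℂ) a with hz
  have e : v * (starRingEnd ℂ) (-a) = -z := by simp [hz]
  rw [e] at h ⊢
  simp only [Complex.neg_re, Complex.neg_im] at h ⊢
  unfold ccwAngle
  rw [← hz]
  have hpi := Real.pi_pos
  have h1 := Complex.neg_pi_lt_arg z
  rcases lt_trichotomy z.im 0 with hi | hi | hi
  · rw [if_pos (Complex.arg_neg_iff.2 hi), Real.sign_of_pos (by linarith),
      Real.sign_of_pos (by linarith)]
  · have : Complex.arg z = π := Complex.arg_eq_pi_iff.2 ⟨by linarith, hi⟩
    rw [this, if_neg (by linarith), hi]; simp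
  · have : Complex.arg z < π := Complex.arg_lt_pi_iff.2 (Or.inr hi.ne')
    rw [if_neg (by rw [Complex.arg_neg_iff]; linarith), Real.sign_of_neg (by linarith),
      Real.sign_of_neg (by linarith)]

lemma geom (u v w : ℂ) (b R : ℝ) (hb : 0 < b) (hu : ‖u‖ = b) (hv : ‖v‖ = b) (hw : ‖w‖ = b)
    (h1 : (v * (starRingEnd ℂ) u).re = R) (h2 : (w * (starRingEnd ℂ) v).re = R) :
    (Real.sign (v * (starRingEnd ℂ) u).im = Real.sign (w * (starRingEnd ℂ) v).im →
      ‖u + v + w‖ = √(3 * b ^ 2 + 4 * R + 2 * ((R ^ 2 - (b ^ 4 - R ^ 2)) / b ^ 2))) ∧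
    (Real.sign (v * (starRingEnd ℂ) u).im ≠ Real.sign (w * (starRingEnd ℂ) v).im →
      ‖u + v + w‖ = √(3 * b ^ 2 + 4 * R + 2 * ((R ^ 2 + (b ^ 4 - R ^ 2)) / b ^ 2)) ∧
      R ^ 2 < b ^ 4) := by
  have nu : u.re ^ 2 + u.im ^ 2 = b ^ 2 := by
    rw [← hu, ← Complex.normSq_eq_norm_sq, Complex.normSq_apply]; ring
  have nv : v.re ^ 2 + v.im ^ 2 = b ^ 2 := by
    rw [← hv, ← Complex.normSq_eq_norm_sq, Complex.normSq_apply]; ring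
  have nw : w.re ^ 2 + w.im ^ 2 = b ^ 2 := by
    rw [← hw, ← Complex.normSq_eq_norm_sq, Complex.normSq_apply]; ring
  set X := (v * (starRingEnd ℂ) u).im with hX
  set Y := (w * (starRingEnd ℂ) v).im with hY
  have eX : X = v.im * u.re - v.re * u.im := by rw [hX]; simp; ring
  have eY : Y = w.im * v.re - w.re * v.im := by rw [hY]; simp; ring
  have e1 : R = v.re * u.re + v.im * u.im := by rw [← h1]; simp
  have e2 : R = w.re * v.re + w.im * v.im := by rw [← h2]; simp
  have hX2 : X ^ 2 = b ^ 4 - R ^ 2 := by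
    have : X ^ 2 + R ^ 2 = (u.re ^ 2 + u.im ^ 2) * (v.re ^ 2 + v.im ^ 2) := by
      rw [eX, e1]; ring
    rw [nu, nv] at this; linarith
  have hY2 : Y ^ 2 = b ^ 4 - R ^ 2 := by
    have : Y ^ 2 + R ^ 2 = (w.re ^ 2 + w.im ^ 2) * (v.re ^ 2 + v.im ^ 2) := by
      rw [eY, e2]; ring
    rw [nw, nv] at this; linarith
  have hwu : b ^ 2 * (w.re * u.re + w.im * u.im) = R ^ 2 - X * Y := by
    have : R ^ 2 - X * Y = (v.re ^ 2 + v.im ^ 2) * (w.re * u.re + w.im * u.im) := by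
      have : R ^ 2 = (v.re * u.re + v.im * u.im) * (w.re * v.re + w.im * v.im) := by
        rw [← e1, ← e2]; ring
      rw [this, eX, eY]; ring
    rw [this, nv]
  have hnorm : ‖u + v + w‖ = √(3 * b ^ 2 + 4 * R + 2 * ((R ^ 2 - X * Y) / b ^ 2)) := by
    rw [← Real.sqrt_sq (norm_nonneg (u + v + w)), ← hwu, mul_div_cancel_left₀ _ (by positivity),
      ← Complex.normSq_eq_norm_sq, Complex.normSq_apply]
    congr 1
    simp only [Complex.add_re, Complex.add_im]
    linear_combination nu + nv + nw - 2 * e1 - 2 * e2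
  have hXY : X = Y ∨ X = -Y := sq_eq_sq_iff_eq_or_eq_neg.1 (hX2.trans hY2.symm)
  constructor
  · intro hs
    have : X = Y := by
      rcases hXY with h | h
      · exact h
      · rcases lt_trichotomy Y 0 with hy | hy | hy
        · rw [Real.sign_of_neg hy, Real.sign_of_pos (by linarith)] at hs; norm_num at hs
        · rw [h, hy]; simp
        · rw [Real.sign_of_pos hy, Real.sign_of_neg (by linarith)] at hs; norm_num at hs
    rw [hnorm, ← hX2, this]; congr 4; ring
  · intro hs
    have h : X = -Y := hXY.resolve_left (fun h => hs (by rw [h]))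
    have hy : Y ≠ 0 := by
      rintro hy
      rw [h, hy] at hs; simp at hs
    refine ⟨?_, by have := pow_pos (abs_pos.2 hy) 2; rw [sq_abs] at this; linarith⟩
    rw [hnorm, ← hY2, h]; congr 4; ring

lemma zigzag (b0 s0 : ℝ) (hb : 0.9 ≤ b0) (hb' : b0 ≤ 1.1) (hs : 0 ≤ s0) (hs' : s0 ≤ 0.1) (n : ℕ) :
    ∃ z : ℕ → ℂ, Admissible n z ∧ ∀ j, ‖z (j + 1) - z j‖ = b0 ∧
      ((z (j + 2) - z (j + 1)) * (starRingEnd ℂ) (z (j + 1) - z j)).re = b0 ^ 2 * (1 - s0) := by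
  norm_num at hb hb' hs'
  set α := b0 * √(1 - s0 / 2) with hα
  set β := b0 * √(s0 / 2) with hβ
  have hα2 : α ^ 2 = b0 ^ 2 * (1 - s0 / 2) := by
    rw [hα, mul_pow, Real.sq_sqrt (by linarith)]
  have hβ2 : β ^ 2 = b0 ^ 2 * (s0 / 2) := by
    rw [hβ, mul_pow, Real.sq_sqrt (by linarith)]
  have hα0 : 0 ≤ α := mul_nonneg (by linarith) (Real.sqrt_nonneg _)
  have hα75 : 3 / 4 < α := by
    have : (3 / 4 : ℝ) ^ 2 < α ^ 2 := by rw [hα2]; nlinarith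
    exact lt_of_pow_lt_pow_left₀ 2 hα0 this
  set z : ℕ → ℂ := fun j => ⟨j * α, if Even j then 0 else β⟩ with hz
  have hre : ∀ j, (z (j + 1) - z j).re = α := by intro j; simp [hz]; ring
  have him : ∀ j, (z (j + 1) - z j).im = if Even j then β else -β := by
    intro j
    by_cases h : Even j <;> simp [hz, h, Nat.even_add_one]
  have hbond : ∀ j, ‖z (j + 1) - z j‖ = b0 := by
    intro j
    rw [← Real.sqrt_sq (norm_nonneg (z (j + 1) - z j)), ← Complex.normSq_eq_norm_sq, Complex.normSq_apply, hre, him]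
    rw [← Real.sqrt_sq (show 0 ≤ b0 by linarith)]
    congr 1
    split_ifs <;> linarith
  refine ⟨z, ⟨?_, ?_⟩, fun j => ⟨hbond j, ?_⟩⟩
  · intro i j _ _ _ _ hij
    have h1 : |(z i - z j).re| ≤ ‖z i - z j‖ := Complex.abs_re_le_norm _
    have h2 : (z i - z j).re = ((i : ℝ) - j) * α := by simp [hz]; ring
    have h3 : 2 ≤ |(i : ℝ) - j| := by
      rw [le_abs]
      rcases hij with h | h
      · right
        have : (i : ℝ) + 2 ≤ j := by exact_mod_cast h
        linarith
      · left
        have : (j : ℝ) + 2 ≤ i := by exact_mod_cast h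
        linarith
    rw [h2, abs_mul, abs_of_nonneg hα0] at h1
    norm_num
    nlinarith
  · intro i _ _
    rw [hbond]; norm_num; linarith
  · rw [Complex.mul_re, Complex.conj_re, Complex.conj_im, hre, hre, him, him]
    by_cases h : Even j <;> simp [h, Nat.even_add_one] <;> linarith

lemma min_struct {v₂ v₃ : ℝ → ℝ} (hp : PotentialPair v₂ v₃) (ρ b0 s0 : ℝ)
    (hb : 0.9 ≤ b0) (hb' : b0 ≤ 1.1) (hs : 0 ≤ s0) (hs' : s0 ≤ 0.1)
    (hcell : ∀ a b s : ℝ, 0 < a → a ≤ 1.5 → 0 < b → b ≤ 1.5 → 1.5 < a + b →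
        0 ≤ s → s ≤ 2 → 0 < dE a b s → FE v₂ v₃ ρ b0 b0 s0 ≤ FE v₂ v₃ ρ a b s ∧
        (FE v₂ v₃ ρ a b s = FE v₂ v₃ ρ b0 b0 s0 → a = b0 ∧ b = b0 ∧ s = s0))
    (n : ℕ) (y : ℕ → ℂ) (hy : MinimizesEred v₂ v₃ ρ n y) :
    ∀ i, 1 ≤ i → i + 2 ≤ n → ‖y (i + 1) - y i‖ = b0 ∧ ‖y (i + 2) - y (i + 1)‖ = b0 ∧
      ((y (i + 2) - y (i + 1)) * (starRingEnd ℂ) (y (i + 1) - y i)).re = b0 ^ 2 * (1 - s0) ∧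
      Ecell v₂ v₃ ρ (y i) (y (i + 1)) (y (i + 2)) = FE v₂ v₃ ρ b0 b0 s0 := by
  have hb0 : 0 < b0 := lt_of_lt_of_le (by norm_num) hb
  -- every admissible cell
  have hadm : ∀ i, 1 ≤ i → i + 2 ≤ n →
      FE v₂ v₃ ρ b0 b0 s0 ≤ Ecell v₂ v₃ ρ (y i) (y (i + 1)) (y (i + 2)) ∧
      (Ecell v₂ v₃ ρ (y i) (y (i + 1)) (y (i + 2)) = FE v₂ v₃ ρ b0 b0 s0 →
        ‖y (i + 1) - y i‖ = b0 ∧ ‖y (i + 2) - y (i + 1)‖ = b0 ∧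
        ((y (i + 2) - y (i + 1)) * (starRingEnd ℂ) (y (i + 1) - y i)).re = b0 ^ 2 * (1 - s0)) := by
    intro i hi hin
    have k1 := hy.1.2 i hi (by omega)
    have k2 := hy.1.2 (i + 1) (by omega) (by omega)
    have k3 := hy.1.1 (i + 2) i (by omega) (by omega) (by omega) (by omega) (by omega)
    set u := y (i + 1) - y i with hu
    set w := y (i + 2) - y (i + 1) with hw
    have hsum : y (i + 2) - y i = u + w := by rw [hu, hw]; ring
    have k4 : 1.5 < ‖u‖ + ‖w‖ := by
      rw [hsum] at k3; exact k3.trans_le (norm_add_le _ _)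
    have pu : 0 < ‖u‖ := by
      have : ‖w‖ ≤ 1.5 := k2
      linarith
    have pw : 0 < ‖w‖ := by linarith
    have nu : u ≠ 0 := norm_pos_iff.1 pu
    have nw : w ≠ 0 := norm_pos_iff.1 pw
    obtain ⟨c1, c2⟩ := cell_eq hp ρ (y i) (y (i + 1)) (y (i + 2)) nu nw
    rw [← hu, ← hw] at c1 c2
    set X := (w * (starRingEnd ℂ) u).re with hX
    have hXabs : |X| ≤ ‖u‖ * ‖w‖ := by
      have := Complex.abs_re_le_norm (w * (starRingEnd ℂ) u)
      rw [norm_mul, RCLike.norm_conj] at this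
      linarith [mul_comm ‖u‖ ‖w‖]
    have hXd : |X / (‖u‖ * ‖w‖)| ≤ 1 := by
      rw [abs_div, abs_of_pos (mul_pos pu pw)]
      exact div_le_one_of_le₀ hXabs (by positivity)
    obtain ⟨q1, q2⟩ := abs_le.1 hXd
    have hd : 0 < dE ‖u‖ ‖w‖ (1 - X / (‖u‖ * ‖w‖)) := by
      rw [← c2]; exact lt_trans (by norm_num) k3
    obtain ⟨m1, m2⟩ := hcell ‖u‖ ‖w‖ (1 - X / (‖u‖ * ‖w‖)) pu k1 pw k2 k4 (by linarith)
      (by linarith) hd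
    refine ⟨by rw [c1]; exact m1, fun h => ?_⟩
    obtain ⟨r1, r2, r3⟩ := m2 (by rw [← c1]; exact h)
    refine ⟨r1, r2, ?_⟩
    rw [r1, r2] at r3
    have : X / (b0 * b0) = 1 - s0 := by linarith
    rw [div_eq_iff (by positivity)] at this
    rw [this]; ring
  obtain ⟨z, hz, hzc⟩ := zigzag b0 s0 hb hb' hs hs' n
  have hzE : ∀ j, Ecell v₂ v₃ ρ (z j) (z (j + 1)) (z (j + 2)) = FE v₂ v₃ ρ b0 b0 s0 := by
    intro j
    have g1 := (hzc j).1
    have g2 := (hzc (j + 1)).1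
    have g3 := (hzc j).2
    rw [show j + 1 + 1 = j + 2 by ring] at g2
    rw [(cell_eq hp ρ (z j) (z (j + 1)) (z (j + 2)) (norm_pos_iff.1 (by rw [g1]; exact hb0))
      (norm_pos_iff.1 (by rw [g2]; exact hb0))).1, g1, g2, g3]
    congr 1
    field_simp
    ring
  have hle := hy.2 z hz
  have hreind : ∀ x : ℕ → ℂ, ∀ i ∈ Finset.Icc 2 (n - 1),
      Ecell v₂ v₃ ρ (x (i - 1)) (x i) (x (i + 1)) =
      Ecell v₂ v₃ ρ (x (i - 1)) (x (i - 1 + 1)) (x (i - 1 + 2)) := by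
    intro x i hi
    rw [Finset.mem_Icc] at hi
    rw [show i - 1 + 1 = i by omega, show i - 1 + 2 = i + 1 by omega]
  unfold Ered at hle
  rw [Finset.sum_congr rfl (hreind y), Finset.sum_congr rfl (hreind z),
    Finset.sum_congr rfl (fun i _ => hzE (i - 1))] at hle
  have hge : ∀ i ∈ Finset.Icc 2 (n - 1), FE v₂ v₃ ρ b0 b0 s0 ≤
      Ecell v₂ v₃ ρ (y (i - 1)) (y (i - 1 + 1)) (y (i - 1 + 2)) := by
    intro i hi
    rw [Finset.mem_Icc] at hi
    exact (hadm (i - 1) (by omega) (by omega)).1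
  have heq := (Finset.sum_eq_sum_iff_of_le hge).1 (le_antisymm (Finset.sum_le_sum hge) hle)
  intro i hi hin
  have h := heq (i + 1) (by rw [Finset.mem_Icc]; omega)
  rw [show i + 1 - 1 = i by omega] at h
  obtain ⟨t1, t2, t3⟩ := (hadm i hi hin).2 h.symm
  exact ⟨t1, t2, t3, h.symm⟩

lemma quad {v₂ v₃ : ℝ → ℝ} (ρ ρ' b0 s0 : ℝ)
    (hb : 0.9 ≤ b0) (hs' : s0 ≤ 0.1) (n : ℕ) (y : ℕ → ℂ)
    (H : ∀ i, 1 ≤ i → i + 2 ≤ n → ‖y (i + 1) - y i‖ = b0 ∧ ‖y (i + 2) - y (i + 1)‖ = b0 ∧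
      ((y (i + 2) - y (i + 1)) * (starRingEnd ℂ) (y (i + 1) - y i)).re = b0 ^ 2 * (1 - s0) ∧
      Ecell v₂ v₃ ρ (y i) (y (i + 1)) (y (i + 2)) = FE v₂ v₃ ρ b0 b0 s0)
    (i : ℕ) (hi : 1 ≤ i) (hin : i + 3 ≤ n) (R : ℝ) (hR : R = b0 ^ 2 * (1 - s0)) :
    EgenCell v₂ v₃ ρ ρ' (y i) (y (i + 1)) (y (i + 2)) (y (i + 3)) =
      FE v₂ v₃ ρ b0 b0 s0 + ρ' * v₂ ‖y (i + 3) - y i‖ ∧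
    (Real.sign (ang y (i + 1) - π) = Real.sign (ang y (i + 2) - π) →
      ‖y (i + 3) - y i‖ = √(3 * b0 ^ 2 + 4 * R + 2 * ((R ^ 2 - (b0 ^ 4 - R ^ 2)) / b0 ^ 2))) ∧
    (Real.sign (ang y (i + 1) - π) ≠ Real.sign (ang y (i + 2) - π) →
      ‖y (i + 3) - y i‖ = √(3 * b0 ^ 2 + 4 * R + 2 * ((R ^ 2 + (b0 ^ 4 - R ^ 2)) / b0 ^ 2)) ∧
      R ^ 2 < b0 ^ 4) := by
  have hb0 : 0 < b0 := lt_of_lt_of_le (by norm_num) hb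
  norm_num at hs'
  have hRpos : 0 < R := by rw [hR]; exact mul_pos (by positivity) (by linarith)
  obtain ⟨a1, a2, a3, a4⟩ := H i hi (by omega)
  obtain ⟨b1, b2, b3, b4⟩ := H (i + 1) (by omega) (by omega)
  rw [show i + 1 + 1 = i + 2 by ring, show i + 1 + 2 = i + 3 by ring] at *
  rw [← hR] at a3 b3
  refine ⟨by unfold EgenCell; rw [a4, b4]; ring, ?_⟩
  have s1 : Real.sign (ang y (i + 1) - π) =
      Real.sign ((y (i + 2) - y (i + 1)) * (starRingEnd ℂ) (y (i + 1) - y i)).im := by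
    have := sign_ang (y i - y (i + 1)) (y (i + 2) - y (i + 1)) (by rw [neg_sub, a3]; exact hRpos)
    rw [neg_sub] at this
    exact this
  have s2 : Real.sign (ang y (i + 2) - π) =
      Real.sign ((y (i + 3) - y (i + 2)) * (starRingEnd ℂ) (y (i + 2) - y (i + 1))).im := by
    have := sign_ang (y (i + 1) - y (i + 2)) (y (i + 3) - y (i + 2)) (by rw [neg_sub, b3]; exact hRpos)
    rw [neg_sub] at this
    exact this
  have g := geom _ _ _ b0 R hb0 a1 a2 b2 a3 b3
  rw [s1, s2, show y (i + 3) - y i =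
    (y (i + 1) - y i) + (y (i + 2) - y (i + 1)) + (y (i + 3) - y (i + 2)) by ring]
  exact g

/-- well-definedness of `e^gen_cell` and `e_per`, and positivity of `e_per`. -/
theorem egen_eper_well_defined (v₂ v₃ : ℝ → ℝ) (hpot : PotentialPair v₂ v₃) :
    ∃ ρ₀ : ℝ, 0 < ρ₀ ∧ ∀ ρ : ℝ, 0 < ρ → ρ ≤ ρ₀ → ∀ ρ' : ℝ, 0 < ρ' →
      ∀ n n' : ℕ, 5 ≤ n → 5 ≤ n' →
        ∀ y y' : ℕ → ℂ, MinimizesEred v₂ v₃ ρ n y → MinimizesEred v₂ v₃ ρ n' y' →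
          ∀ i i' : ℕ, 1 ≤ i → i + 3 ≤ n → 1 ≤ i' → i' + 3 ≤ n' →
            (Real.sign (ang y (i + 1) - π) = Real.sign (ang y (i + 2) - π) →
              Real.sign (ang y' (i' + 1) - π) = Real.sign (ang y' (i' + 2) - π) →
                EgenCell v₂ v₃ ρ ρ' (y i) (y (i + 1)) (y (i + 2)) (y (i + 3)) =
                  EgenCell v₂ v₃ ρ ρ' (y' i') (y' (i' + 1)) (y' (i' + 2)) (y' (i' + 3))) ∧
            (Real.sign (ang y (i + 1) - π) ≠ Real.sign (ang y (i + 2) - π) →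
              Real.sign (ang y' (i' + 1) - π) ≠ Real.sign (ang y' (i' + 2) - π) →
                EgenCell v₂ v₃ ρ ρ' (y i) (y (i + 1)) (y (i + 2)) (y (i + 3)) =
                  EgenCell v₂ v₃ ρ ρ' (y' i') (y' (i' + 1)) (y' (i' + 2)) (y' (i' + 3))) ∧
            (Real.sign (ang y (i + 1) - π) ≠ Real.sign (ang y (i + 2) - π) →
              Real.sign (ang y' (i' + 1) - π) = Real.sign (ang y' (i' + 2) - π) →
                ‖y' (i' + 3) - y' i'‖ < ‖y (i + 3) - y i‖ ∧
                EgenCell v₂ v₃ ρ ρ' (y' i') (y' (i' + 1)) (y' (i' + 2)) (y' (i' + 3)) <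
                  EgenCell v₂ v₃ ρ ρ' (y i) (y (i + 1)) (y (i + 2)) (y (i + 3))) := by
  obtain ⟨ρ₀, hρ₀, hmain⟩ := cell_structure hpot
  refine ⟨ρ₀, hρ₀, ?_⟩
  intro ρ hρ hρ0 ρ' hρ' n n' hn hn' y y' hy hy' i i' hi hin hi' hin'
  obtain ⟨b0, s0, hb, hb', hs, hs', hcell⟩ := hmain ρ hρ hρ0
  have hb0 : 0 < b0 := lt_of_lt_of_le (by norm_num) hb
  have hs1 : s0 ≤ 1 / 10 := by norm_num at hs'; exact hs'
  have H := min_struct hpot ρ b0 s0 hb hb' hs hs' hcell n y hy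
  have H' := min_struct hpot ρ b0 s0 hb hb' hs hs' hcell n' y' hy'
  obtain ⟨e, p1, p2⟩ := quad ρ ρ' b0 s0 hb hs' n y H i hi hin _ rfl
  obtain ⟨e', p1', p2'⟩ := quad ρ ρ' b0 s0 hb hs' n' y' H' i' hi' hin' _ rfl
  refine ⟨fun h h' => ?_, fun h h' => ?_, fun h h' => ?_⟩
  · rw [e, e', p1 h, p1' h']
  · rw [e, e', (p2 h).1, (p2' h').1]
  · have hlt : ‖y' (i' + 3) - y' i'‖ < ‖y (i + 3) - y i‖ := by
      have hR0 : 0 < b0 ^ 2 * (1 - s0) := mul_pos (by positivity) (by linarith)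
      obtain ⟨q1, q2⟩ := p2 h
      rw [p1' h', q1]
      generalize b0 ^ 2 * (1 - s0) = R at *
      apply Real.sqrt_lt_sqrt_iff_of_pos _ |>.2
      · gcongr
        linarith
      · rw [add_sub_cancel]
        positivity
    refine ⟨hlt, ?_⟩
    have k := hy'.1.1 (i' + 3) i' (by omega) (by omega) (by omega) (by omega) (by omega)
    norm_num at k
    rw [e, e']
    have := hpot.v₂_mono (show (1 : ℝ) ≤ ‖y' (i' + 3) - y' i'‖ by linarith)
      (show (1 : ℝ) ≤ ‖y (i + 3) - y i‖ by linarith) hlt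
    have := mul_lt_mul_of_pos_left this hρ'
    linarith

end
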